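/- Let K be a shifted simplicial complex on [n]. For each r, the (r-1)-st reduced Betti number of K over a field equals the number of facets of K of cardinality r that do not contain the vertex 1: β_{r-1}(K) = |{ F ∈ max(K) : |F| = r, 1 ∉ F }|. -/

import Mathlib

/-- A simplicial complex on vertex set `[n] = {1,...,n}`. -/
def IsComplex (n : ℕ) (K : Set (Finset ℕ)) : Prop :=
  (∀ F ∈ K, F ⊆ Finset.Icc 1 n) ∧ ∀ F ∈ K, ∀ G ⊆ F, G ∈ K

/-- `K` is shifted. -/
def IsShifted (K : Set (Finset ℕ)) : Prop :=
  ∀ F ∈ K, ∀ i ∈ F, ∀ j : ℕ, 1 ≤ j → j < i → insert j (F.erase i) ∈ K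

/-- A facet is a maximal face. -/
def IsFacet (K : Set (Finset ℕ)) (F : Finset ℕ) : Prop :=
  F ∈ K ∧ ∀ G ∈ K, F ⊆ G → F = G

/-- The simplicial boundary operator on the free `k`-module on all finite subsets
of `ℕ`: `∂(F) = ∑_{a ∈ F} (-1)^{|{b ∈ F : b < a}|} (F ∖ {a})`.  (Note that
`∂({a}) = ∅`, so this is the *augmented* (reduced) chain complex.) -/
noncomputable def bdry (k : Type*) [Field k] :
    (Finset ℕ →₀ k) →ₗ[k] (Finset ℕ →₀ k) :=
  Finsupp.lsum k fun F => LinearMap.toSpanSingleton k _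
    (∑ a ∈ F, ((-1 : k) ^ ((F.filter (· < a)).card)) • Finsupp.single (F.erase a) (1 : k))

/-- The space of `r`-chains of `K`: spanned by the faces of cardinality `r`. -/
noncomputable def chains (k : Type*) [Field k] (K : Set (Finset ℕ)) (r : ℕ) :
    Submodule k (Finset ℕ →₀ k) :=
  Submodule.span k { x | ∃ F ∈ K, F.card = r ∧ x = Finsupp.single F (1 : k) }

/-- The reduced Betti number `β_{r-1}(K; k)`: the dimension of the reduced
homology of `K` in the homological position corresponding to faces of
cardinality `r`. -/
noncomputable def redBetti (k : Type*) [Field k] (K : Set (Finset ℕ)) (r : ℕ) : ℕ :=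
  Module.finrank k ↥(chains k K r ⊓ LinearMap.ker (bdry k)) -
    Module.finrank k ↥(Submodule.map (bdry k) (chains k K (r + 1)))

lemma bdry_single (k : Type*) [Field k] (F : Finset ℕ) :
    bdry k (Finsupp.single F 1) =
      ∑ a ∈ F, ((-1 : k) ^ ((F.filter (· < a)).card)) • Finsupp.single (F.erase a) (1 : k) := by
  simp [bdry]

lemma sign_mul_sign_erase_of_lt (k : Type*) [Field k] {F : Finset ℕ} {a b : ℕ}
    (hb : b ∈ F) (h : b < a) :
    (-1 : k) ^ (F.filter (· < a)).card * (-1 : k) ^ ((F.erase a).filter (· < b)).card =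
      -((-1 : k) ^ (F.filter (· < b)).card * (-1 : k) ^ ((F.erase b).filter (· < a)).card) := by
  have h₁ : (F.erase a).filter (· < b) = F.filter (· < b) := by
    ext x
    simp only [Finset.mem_filter, Finset.mem_erase]
    grind
  have h₂ : ((F.erase b).filter (· < a)).card + 1 = (F.filter (· < a)).card := by
    rw [Finset.filter_erase]
    exact Finset.card_erase_add_one (by simp [hb, h])
  rw [h₁, ← h₂, pow_succ]
  ring

lemma sign_mul_sign_erase (k : Type*) [Field k] {F : Finset ℕ} {a b : ℕ}
    (ha : a ∈ F) (hb : b ∈ F) (h : b ≠ a) :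
    (-1 : k) ^ (F.filter (· < a)).card * (-1 : k) ^ ((F.erase a).filter (· < b)).card =
      -((-1 : k) ^ (F.filter (· < b)).card * (-1 : k) ^ ((F.erase b).filter (· < a)).card) := by
  rcases h.lt_or_gt with h | h
  · exact sign_mul_sign_erase_of_lt k hb h
  · rw [sign_mul_sign_erase_of_lt k ha h, neg_neg]

lemma bdry_bdry_single (k : Type*) [Field k] (F : Finset ℕ) :
    bdry k (bdry k (Finsupp.single F 1)) = 0 := by
  rw [bdry_single, map_sum]
  simp only [map_smul, bdry_single, Finset.smul_sum, smul_smul]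
  rw [Finset.sum_sigma']
  refine Finset.sum_involution (fun x _ => ⟨x.2, x.1⟩) ?_ ?_ ?_ ?_
  · rintro ⟨a, b⟩ h
    simp only [Finset.mem_sigma, Finset.mem_erase] at h
    rw [sign_mul_sign_erase k h.1 h.2.2 h.2.1, Finset.erase_right_comm, neg_smul, neg_add_cancel]
  · rintro ⟨a, b⟩ h _ heq
    simp only [Finset.mem_sigma, Finset.mem_erase] at h
    exact h.2.1 (congrArg Sigma.fst heq)
  · rintro ⟨a, b⟩ h
    simp only [Finset.mem_sigma, Finset.mem_erase] at h ⊢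
    exact ⟨h.2.2, h.2.1.symm, h.1⟩
  · rintro ⟨a, b⟩ _
    rfl

/-- The cone operator with apex `1`: it sends `F` to `F ∪ {1}` if `1 ∉ F` and to `0` otherwise. -/
noncomputable def coneOp (k : Type*) [Field k] :
    (Finset ℕ →₀ k) →ₗ[k] (Finset ℕ →₀ k) :=
  Finsupp.lsum k fun F => LinearMap.toSpanSingleton k _
    (if 1 ∈ F then 0 else Finsupp.single (insert 1 F) (1 : k))

lemma coneOp_single (k : Type*) [Field k] (F : Finset ℕ) :
    coneOp k (Finsupp.single F 1) =
      if 1 ∈ F then 0 else Finsupp.single (insert 1 F) (1 : k) := by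
  simp [coneOp]

lemma coneOp_bdry_single_of_notMem (k : Type*) [Field k] {F : Finset ℕ} (h : 1 ∉ F) :
    coneOp k (bdry k (Finsupp.single F 1)) =
      ∑ a ∈ F, ((-1 : k) ^ ((F.filter (· < a)).card)) •
        Finsupp.single (insert 1 (F.erase a)) (1 : k) := by
  rw [bdry_single, map_sum]
  refine Finset.sum_congr rfl fun a _ => ?_
  rw [map_smul, coneOp_single, if_neg (by simp [h])]

lemma coneOp_bdry_single_of_mem (k : Type*) [Field k] {F : Finset ℕ} (h₀ : 0 ∉ F) (h : 1 ∈ F) :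
    coneOp k (bdry k (Finsupp.single F 1)) = Finsupp.single F 1 := by
  have hF : F.filter (· < 1) = ∅ := by
    ext x
    simp only [Finset.mem_filter, Nat.lt_one_iff, Finset.notMem_empty, iff_false]
    rintro ⟨hx, rfl⟩
    exact h₀ hx
  rw [bdry_single, map_sum, Finset.sum_eq_single_of_mem 1 h]
  · rw [map_smul, coneOp_single, if_neg (by simp), hF, Finset.insert_erase h]
    simp
  · intro a _ ha
    rw [map_smul, coneOp_single, if_pos (by simp [h, ha.symm]), smul_zero]

lemma bdry_coneOp_single_of_notMem (k : Type*) [Field k] {F : Finset ℕ}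
    (h₀ : 0 ∉ F) (h : 1 ∉ F) :
    bdry k (coneOp k (Finsupp.single F 1)) =
      Finsupp.single F 1 - coneOp k (bdry k (Finsupp.single F 1)) := by
  have hF : (insert 1 F).filter (· < 1) = ∅ := by
    ext x
    simp only [Finset.mem_filter, Nat.lt_one_iff, Finset.notMem_empty, iff_false]
    rintro ⟨hx, rfl⟩
    simp [h₀] at hx
  rw [coneOp_bdry_single_of_notMem k h, coneOp_single, if_neg h, bdry_single,
    Finset.sum_insert h, hF, Finset.erase_insert h, sub_eq_add_neg, ← Finset.sum_neg_distrib]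
  congr 1
  · simp
  · refine Finset.sum_congr rfl fun a ha => ?_
    have ha₁ : 1 < a := by
      have h0 : a ≠ 0 := fun h => h₀ (h ▸ ha)
      have h1 : a ≠ 1 := fun h' => h (h' ▸ ha)
      omega
    rw [Finset.filter_insert, if_pos ha₁, Finset.card_insert_of_notMem (by simp [h]),
      Finset.erase_insert_of_ne ha₁.ne, pow_succ, mul_neg_one, neg_smul]

lemma bdry_coneOp_bdry_single (k : Type*) [Field k] {F : Finset ℕ} (h₀ : 0 ∉ F) (h : 1 ∉ F) :
    bdry k (coneOp k (bdry k (Finsupp.single F 1))) = bdry k (Finsupp.single F 1) := by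
  have key : coneOp k (bdry k (Finsupp.single F 1)) =
      Finsupp.single F 1 - bdry k (coneOp k (Finsupp.single F 1)) := by
    rw [bdry_coneOp_single_of_notMem k h₀ h, sub_sub_cancel]
  have hsq : bdry k (bdry k (coneOp k (Finsupp.single F 1))) = 0 := by
    rw [coneOp_single, if_neg h, bdry_bdry_single]
  rw [key, map_sub, hsq, sub_zero]

lemma finrank_span_single (k : Type*) [Field k] {α : Type*} (S : Set α) :
    Module.finrank k ↥(Submodule.span k ((fun a => Finsupp.single a (1 : k)) '' S)) =
      S.ncard := by
  rw [← Finsupp.supported_eq_span_single, (Finsupp.supportedEquivFinsupp S).finrank_eq]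
  rw [Module.finrank, rank_finsupp_self, Cardinal.toNat_lift, ← Nat.card, Nat.card_coe_set_eq]

lemma chains_eq_span_image (k : Type*) [Field k] (K : Set (Finset ℕ)) (r : ℕ) :
    chains k K r = Submodule.span k
      ((fun F => Finsupp.single F (1 : k)) '' {F | F ∈ K ∧ F.card = r}) := by
  unfold chains
  congr 1
  ext x
  simp only [Set.mem_ofPred_eq, Set.mem_image, and_assoc, eq_comm]

lemma finrank_chains (k : Type*) [Field k] (K : Set (Finset ℕ)) (r : ℕ) :
    Module.finrank k ↥(chains k K r) = {F | F ∈ K ∧ F.card = r}.ncard := by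
  rw [chains_eq_span_image, finrank_span_single]

lemma IsComplex.zero_notMem {n : ℕ} {K : Set (Finset ℕ)} (hc : IsComplex n K) {F : Finset ℕ}
    (hF : F ∈ K) : 0 ∉ F := fun h => by
  simpa using hc.1 F hF h

lemma IsComplex.finite {n : ℕ} {K : Set (Finset ℕ)} (hc : IsComplex n K) : K.Finite :=
  (Finset.finite_toSet (Finset.Icc 1 n).powerset).subset fun F hF =>
    Finset.mem_coe.2 (Finset.mem_powerset.2 (hc.1 F hF))

/-- The faces through the vertex `1` generate all boundaries of a shifted complex. -/
lemma map_bdry_chains (k : Type*) [Field k] {n : ℕ} {K : Set (Finset ℕ)}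
    (hc : IsComplex n K) (hs : IsShifted K) (r : ℕ) :
    (chains k K r).map (bdry k) = (Submodule.span k
      ((fun F => Finsupp.single F (1 : k)) '' {F | (F ∈ K ∧ F.card = r) ∧ 1 ∈ F})).map
        (bdry k) := by
  refine le_antisymm ?_ ?_
  · rw [chains_eq_span_image, Submodule.map_span, Submodule.span_le]
    rintro _ ⟨_, ⟨F, hF, rfl⟩, rfl⟩
    by_cases h : 1 ∈ F
    · exact Submodule.mem_map_of_mem (Submodule.subset_span ⟨F, ⟨hF, h⟩, rfl⟩)
    · have h₀ := hc.zero_notMem hF.1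
      simp only [SetLike.mem_coe]
      rw [← bdry_coneOp_bdry_single k h₀ h]
      refine Submodule.mem_map_of_mem ?_
      rw [coneOp_bdry_single_of_notMem k h]
      refine Submodule.sum_mem _ fun a ha => Submodule.smul_mem _ _ (Submodule.subset_span ?_)
      have ha₁ : 1 < a := by
        have h0 : a ≠ 0 := fun h => h₀ (h ▸ ha)
        have h1 : a ≠ 1 := fun h' => h (h' ▸ ha)
        omega
      refine ⟨_, ⟨⟨hs F hF.1 a ha 1 le_rfl ha₁, ?_⟩, Finset.mem_insert_self _ _⟩, rfl⟩
      rw [Finset.card_insert_of_notMem (by simp [h]), Finset.card_erase_add_one ha, hF.2]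
  · rw [chains_eq_span_image]
    exact Submodule.map_mono (Submodule.span_mono (Set.image_mono fun F hF => hF.1))

lemma finrank_map_bdry_chains (k : Type*) [Field k] {n : ℕ} {K : Set (Finset ℕ)}
    (hc : IsComplex n K) (hs : IsShifted K) (r : ℕ) :
    Module.finrank k ↥((chains k K r).map (bdry k)) =
      {F | (F ∈ K ∧ F.card = r) ∧ 1 ∈ F}.ncard := by
  rw [map_bdry_chains k hc hs, ← finrank_span_single k]
  set B := Submodule.span k
    ((fun F => Finsupp.single F (1 : k)) '' {F | (F ∈ K ∧ F.card = r) ∧ 1 ∈ F})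
  have hinv : ∀ x ∈ B, coneOp k (bdry k x) = x := by
    intro x hx
    refine LinearMap.eqOn_span (f := coneOp k ∘ₗ bdry k) (g := LinearMap.id) ?_ hx
    rintro _ ⟨F, hF, rfl⟩
    exact coneOp_bdry_single_of_mem k (hc.zero_notMem hF.1.1) hF.2
  have hinj : Function.Injective ((bdry k).domRestrict B) := by
    intro x y hxy
    have h := congrArg (coneOp k) hxy
    simp only [LinearMap.domRestrict_apply] at h
    rw [hinv x x.2, hinv y y.2] at h
    exact Subtype.ext h
  rw [← LinearMap.range_domRestrict, LinearMap.finrank_range_of_inj hinj]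

lemma finrank_inf_ker_add_finrank_map {k V W : Type*} [Field k] [AddCommGroup V] [Module k V]
    [AddCommGroup W] [Module k W] (f : V →ₗ[k] W) (p : Submodule k V) [FiniteDimensional k p] :
    Module.finrank k ↥(p ⊓ LinearMap.ker f) + Module.finrank k ↥(p.map f) =
      Module.finrank k p := by
  rw [← LinearMap.finrank_range_add_finrank_ker (f.domRestrict p), LinearMap.range_domRestrict,
    LinearMap.ker_domRestrict, ← Submodule.map_comap_subtype, Submodule.finrank_map_subtype_eq,
    add_comm]

lemma isFacet_iff_insert_one_notMem {n : ℕ} {K : Set (Finset ℕ)}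
    (hc : IsComplex n K) (hs : IsShifted K) {F : Finset ℕ} (hF : F ∈ K) (h : 1 ∉ F) :
    IsFacet K F ↔ insert 1 F ∉ K := by
  refine ⟨fun hf hK => h ?_, fun hK => ⟨hF, fun G hG hFG => ?_⟩⟩
  · rw [hf.2 _ hK (Finset.subset_insert _ _)]
    exact Finset.mem_insert_self _ _
  · by_contra hne
    obtain ⟨i, hiG, hiF⟩ := Finset.exists_of_ssubset (hFG.ssubset_of_ne hne)
    have hi : insert i F ∈ K := hc.2 G hG _ (Finset.insert_subset hiG hFG)
    have hi₀ : i ≠ 0 := fun h0 => hc.zero_notMem hG (h0 ▸ hiG)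
    rcases eq_or_ne i 1 with rfl | hi₁
    · exact hK hi
    · have := hs _ hi i (Finset.mem_insert_self _ _) 1 le_rfl (by omega)
      rw [Finset.erase_insert hiF] at this
      exact hK this

lemma ncard_insert_one_mem {n : ℕ} {K : Set (Finset ℕ)} (hc : IsComplex n K) (r : ℕ) :
    {F | (F ∈ K ∧ F.card = r) ∧ 1 ∉ F ∧ insert 1 F ∈ K}.ncard =
      {F | (F ∈ K ∧ F.card = r + 1) ∧ 1 ∈ F}.ncard := by
  refine Set.ncard_congr (fun F _ => insert 1 F) ?_ ?_ ?_
  · rintro F ⟨⟨_, hr⟩, h, hK⟩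
    exact ⟨⟨hK, by rw [Finset.card_insert_of_notMem h, hr]⟩, Finset.mem_insert_self _ _⟩
  · rintro F G ⟨_, hF, _⟩ ⟨_, hG, _⟩ h
    rw [← Finset.erase_insert hF, h, Finset.erase_insert hG]
  · rintro F ⟨⟨hF, hr⟩, h⟩
    refine ⟨F.erase 1, ⟨⟨hc.2 F hF _ (Finset.erase_subset _ _), ?_⟩, by simp, ?_⟩,
      Finset.insert_erase h⟩
    · rw [Finset.card_erase_of_mem h, hr, Nat.add_sub_cancel]
    · rwa [Finset.insert_erase h]

/-- For a shifted simplicial complex `K`, the reduced Betti number `β_{r-1}(K)`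
equals the number of facets of `K` of cardinality `r` not containing vertex `1`. -/
theorem shifted_redBetti_eq_card_facets
    (k : Type*) [Field k] (n : ℕ) (K : Set (Finset ℕ))
    (hc : IsComplex n K) (hs : IsShifted K) (r : ℕ) :
    redBetti k K r = Set.ncard { F | IsFacet K F ∧ F.card = r ∧ 1 ∉ F } := by
  have hfin : {F | F ∈ K ∧ F.card = r}.Finite := hc.finite.subset fun F hF => hF.1
  have : FiniteDimensional k ↥(chains k K r) := by
    rw [chains_eq_span_image]
    exact FiniteDimensional.span_of_finite k (hfin.image _)
  have hrank := finrank_inf_ker_add_finrank_map (bdry k) (chains k K r)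
  rw [finrank_map_bdry_chains k hc hs, finrank_chains] at hrank
  have hsplit := Set.ncard_inter_add_ncard_sdiff_eq_ncard {F | F ∈ K ∧ F.card = r}
    {F | 1 ∈ F} hfin
  have hsplit' := Set.ncard_inter_add_ncard_sdiff_eq_ncard
    ({F | F ∈ K ∧ F.card = r} \ {F | 1 ∈ F}) {F | insert 1 F ∈ K} hfin.sdiff
  have hB : {F | F ∈ K ∧ F.card = r} ∩ {F | 1 ∈ F} =
      {F | (F ∈ K ∧ F.card = r) ∧ 1 ∈ F} := rfl
  have hA : ({F | F ∈ K ∧ F.card = r} \ {F | 1 ∈ F}) ∩ {F | insert 1 F ∈ K} =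
      {F | (F ∈ K ∧ F.card = r) ∧ 1 ∉ F ∧ insert 1 F ∈ K} :=
    Set.ext fun F => and_assoc
  have hC : ({F | F ∈ K ∧ F.card = r} \ {F | 1 ∈ F}) \ {F | insert 1 F ∈ K} =
      {F | IsFacet K F ∧ F.card = r ∧ 1 ∉ F} := by
    ext F
    constructor
    · rintro ⟨⟨⟨hF, hr⟩, h⟩, hK⟩
      exact ⟨(isFacet_iff_insert_one_notMem hc hs hF h).2 hK, hr, h⟩
    · rintro ⟨hf, hr, h⟩
      exact ⟨⟨⟨hf.1, hr⟩, h⟩, (isFacet_iff_insert_one_notMem hc hs hf.1 h).1 hf⟩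
  rw [hB] at hsplit
  rw [hA, hC, ncard_insert_one_mem hc] at hsplit'
  rw [redBetti, finrank_map_bdry_chains k hc hs]
  omega
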